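/- In the free group on 2g generators A_1, B_1, …, A_g, B_g, the product of commutators (A_1 B_1 A_1^{−1} B_1^{−1})(A_2 B_2 A_2^{−1} B_2^{−1}) ⋯ (A_g B_g A_g^{−1} B_g^{−1}) can be written as a product of 2g+1 squares: there exist elements C_0, C_1, …, C_{2g} of the free group such that the commutator product equals C_0^2 C_1^2 ⋯ C_{2g}^2. Explicitly, with S_0 = T_0 = 1, S_k = S_{k−1} A_k B_k A_k^{−1} B_k^{−1}, T_k = B_k A_k T_{k−1}, U_k = S_{k−1} A_k B_k T_{k−1}, V_k = T_{k−1}^{−1} B_k^{−1} A_k^{−1} S_{k−1}^{−1} T_{k−1}^{−1} B_k T_{k−1}, and W_k = T_{k−1}^{−1} B_k^{−1} T_{k−1} S_{k−1} T_{k−1}, one has (U_g U_g)(V_g V_g)(W_g W_g)(V_{g−1} V_{g−1})(W_{g−1} W_{g−1}) ⋯ (V_1 V_1)(W_1 W_1) = Π_{k=1}^g A_k B_k A_k^{−1} B_k^{−1}. -/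

import Mathlib

noncomputable section

namespace IsingPfaffian

/-- The free group on the `2g` generators `A_1, B_1, …, A_g, B_g`. -/
abbrev FG (g : ℕ) : Type := FreeGroup (Fin g ⊕ Fin g)

/-- The generator `A_{k+1}` (0-indexed `k`). -/
def genA {g : ℕ} (k : Fin g) : FG g := FreeGroup.of (Sum.inl k)

/-- The generator `B_{k+1}` (0-indexed `k`). -/
def genB {g : ℕ} (k : Fin g) : FG g := FreeGroup.of (Sum.inr k)

/-- Prefixes of the reversed product of the `V k ^ 2 * W k ^ 2` telescope. -/
theorem prod_reverse_sq_mul_sq {G : Type*} [Group G] {g : ℕ} {S T : ℕ → G}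
    {A B V W : Fin g → G} (hS0 : S 0 = 1) (hT0 : T 0 = 1)
    (hS : ∀ k : Fin g, S (k.val + 1) = S k.val * A k * B k * (A k)⁻¹ * (B k)⁻¹)
    (hT : ∀ k : Fin g, T (k.val + 1) = B k * A k * T k.val)
    (hV : ∀ k : Fin g, V k =
      (T k.val)⁻¹ * (B k)⁻¹ * (A k)⁻¹ * (S k.val)⁻¹ * (T k.val)⁻¹ * B k * T k.val)
    (hW : ∀ k : Fin g, W k = (T k.val)⁻¹ * (B k)⁻¹ * T k.val * S k.val * T k.val)
    (n : ℕ) (hn : n ≤ g) :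
    ((List.ofFn (fun k : Fin n =>
        V (Fin.castLE hn k) ^ 2 * W (Fin.castLE hn k) ^ 2)).reverse).prod =
      (T n * S n * T n)⁻¹ := by
  induction n with
  | zero => simp [hS0, hT0]
  | succ n ih =>
    have hS' := hS ⟨n, hn⟩
    have hT' := hT ⟨n, hn⟩
    have hlast : Fin.castLE hn (Fin.last n) = ⟨n, hn⟩ := rfl
    rw [List.ofFn_succ', List.concat_eq_append, List.reverse_append, List.prod_append]
    simp only [Fin.castLE_castSucc]
    rw [ih (by omega), hlast, hV, hW]
    simp only at hS' hT'
    rw [hS', hT']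
    simp only [List.reverse_singleton, List.prod_singleton, pow_two]
    group

/-- Prefixes of the product of commutators are the `S n`. -/
theorem prod_commutators_eq {G : Type*} [Group G] {g : ℕ} {S : ℕ → G}
    {A B : Fin g → G} (hS0 : S 0 = 1)
    (hS : ∀ k : Fin g, S (k.val + 1) = S k.val * A k * B k * (A k)⁻¹ * (B k)⁻¹)
    (n : ℕ) (hn : n ≤ g) :
    (List.ofFn (fun k : Fin n => A (Fin.castLE hn k) * B (Fin.castLE hn k) *
      (A (Fin.castLE hn k))⁻¹ * (B (Fin.castLE hn k))⁻¹)).prod = S n := by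
  induction n with
  | zero => simp [hS0]
  | succ n ih =>
    have hS' := hS ⟨n, hn⟩
    have hlast : Fin.castLE hn (Fin.last n) = ⟨n, hn⟩ := rfl
    rw [List.ofFn_succ', List.concat_eq_append, List.prod_append]
    simp only [Fin.castLE_castSucc]
    rw [ih (by omega), hlast]
    simp only at hS'
    rw [hS']
    simp only [List.prod_singleton, mul_assoc]

theorem prod_map_sq_flatMap_pair {ι M : Type*} [Monoid M] (V W : ι → M) (l : List ι) :
    ((l.flatMap fun k => [V k, W k]).map (· ^ 2)).prod =
      (l.map fun k => V k ^ 2 * W k ^ 2).prod := by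
  induction l with
  | nil => rfl
  | cons k l ih => simp [ih, mul_assoc]

theorem exists_prod_ofFn_sq {M : Type*} [Monoid M] (L : List M) {n : ℕ} (hL : L.length = n) :
    ∃ C : Fin n → M, (L.map (· ^ 2)).prod = (List.ofFn fun j => C j ^ 2).prod := by
  subst hL
  refine ⟨L.get, ?_⟩
  conv_lhs => rw [← List.ofFn_get L, List.map_ofFn]
  rfl

/-- In the free group on `A_1, B_1, …, A_g, B_g`, the product of commutators
`[A_1,B_1] ⋯ [A_g,B_g]` is a product of `2g+1` squares; explicitly, with
`S_0 = T_0 = 1`, `S_k = S_{k-1} A_k B_k A_k⁻¹ B_k⁻¹`, `T_k = B_k A_k T_{k-1}`,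
`U_k = S_{k-1} A_k B_k T_{k-1}`,
`V_k = T_{k-1}⁻¹ B_k⁻¹ A_k⁻¹ S_{k-1}⁻¹ T_{k-1}⁻¹ B_k T_{k-1}` and
`W_k = T_{k-1}⁻¹ B_k⁻¹ T_{k-1} S_{k-1} T_{k-1}` (here 0-indexed: `U k` is the paper's
`U_{k+1}`, etc.), one has
`(U_g)² (V_g)² (W_g)² (V_{g-1})² (W_{g-1})² ⋯ (V_1)² (W_1)² = [A_1,B_1] ⋯ [A_g,B_g]`. -/
theorem commutator_product_eq_product_of_squares
    (g : ℕ) (hg : 0 < g)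
    (S T : ℕ → FG g) (U Vel W : Fin g → FG g)
    (hS0 : S 0 = 1) (hT0 : T 0 = 1)
    (hS : ∀ k : Fin g,
      S (k.val + 1) = S k.val * genA k * genB k * (genA k)⁻¹ * (genB k)⁻¹)
    (hT : ∀ k : Fin g, T (k.val + 1) = genB k * genA k * T k.val)
    (hU : ∀ k : Fin g, U k = S k.val * genA k * genB k * T k.val)
    (hV : ∀ k : Fin g, Vel k =
      (T k.val)⁻¹ * (genB k)⁻¹ * (genA k)⁻¹ * (S k.val)⁻¹ * (T k.val)⁻¹ * genB k * T k.val)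
    (hW : ∀ k : Fin g, W k = (T k.val)⁻¹ * (genB k)⁻¹ * T k.val * S k.val * T k.val) :
    (U ⟨g - 1, by omega⟩) ^ 2 *
        ((List.ofFn (fun k : Fin g => (Vel k) ^ 2 * (W k) ^ 2)).reverse).prod =
      (List.ofFn (fun k : Fin g => genA k * genB k * (genA k)⁻¹ * (genB k)⁻¹)).prod ∧
    ∃ C : Fin (2 * g + 1) → FG g,
      (List.ofFn (fun k : Fin g => genA k * genB k * (genA k)⁻¹ * (genB k)⁻¹)).prod =
        (List.ofFn (fun j : Fin (2 * g + 1) => (C j) ^ 2)).prod := by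
  have key : (U ⟨g - 1, by omega⟩) ^ 2 *
        ((List.ofFn (fun k : Fin g => (Vel k) ^ 2 * (W k) ^ 2)).reverse).prod =
      (List.ofFn (fun k : Fin g => genA k * genB k * (genA k)⁻¹ * (genB k)⁻¹)).prod := by
    have hC := prod_commutators_eq hS0 hS g le_rfl
    have hQ := prod_reverse_sq_mul_sq hS0 hT0 hS hT hV hW g le_rfl
    simp only [Fin.castLE_rfl, id] at hC hQ
    rw [hC, hQ, hU]
    have hS' := hS ⟨g - 1, by omega⟩
    have hT' := hT ⟨g - 1, by omega⟩
    simp only [Nat.sub_add_cancel hg] at hS' hT'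
    rw [hS', hT']
    simp only [pow_two]
    group
  refine ⟨key, ?_⟩
  obtain ⟨C, hC⟩ := exists_prod_ofFn_sq (n := 2 * g + 1)
    (U ⟨g - 1, by omega⟩ :: (List.finRange g).reverse.flatMap fun k => [Vel k, W k])
    (by simp [List.length_flatMap, mul_comm])
  refine ⟨C, ?_⟩
  rw [← key, ← hC, List.map_cons, List.prod_cons, prod_map_sq_flatMap_pair, List.map_reverse,
    List.ofFn_eq_map]

end IsingPfaffian
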